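/- For every p ∈ (1,∞) there exists C_p ∈ (0,∞) such that for every n ∈ ℕ and every function f : 𝒞_n → ℂ, ‖f − E_{σ_n} f‖_{L_p(σ_n)} ≤ C_p ‖∇f‖_{L_p(σ_n)} / (1 + √(log(‖∇f‖_{L_p(σ_n)} / ‖∇f‖_{L_1(σ_n)}))), with the convention that the right-hand side is 0 when ∇f vanishes identically. -/

import Mathlib

open Finset MeasureTheory Real Filter

noncomputable section

/-- The discrete hypercube `𝒞_n = {-1,1}^n`, encoded as `Fin n → Bool`. -/
abbrev Cube (n : ℕ) := Fin n → Bool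

/-- The sign `±1` associated to a boolean coordinate. -/
def sgn' (b : Bool) : ℝ := if b then 1 else -1

/-- Flip the `i`-th coordinate of a point of the hypercube. -/
def flipC {n : ℕ} (i : Fin n) (x : Cube n) : Cube n := Function.update x i (!(x i))

variable {E : Type*} [NormedAddCommGroup E]

/-- Expectation `E_{σ_n} f` with respect to the uniform probability measure on the cube. -/
def cubeAvg {n : ℕ} [NormedSpace ℝ E] (f : Cube n → E) : E :=
  (2 ^ n : ℝ)⁻¹ • ∑ x : Cube n, f x

/-- The discrete partial derivative `∂_i f (ε) = (f(ε) - f(ε with i-th coordinate flipped))/2`. -/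
def dparC {n : ℕ} [NormedSpace ℝ E] (i : Fin n) (f : Cube n → E) : Cube n → E :=
  fun x => (2 : ℝ)⁻¹ • (f x - f (flipC i x))

/-- The `L_p(σ_n; E)` norm of a function on the hypercube. -/
def cubeLp {n : ℕ} (p : ℝ) (f : Cube n → E) : ℝ :=
  ((2 ^ n : ℝ)⁻¹ * ∑ x : Cube n, ‖f x‖ ^ p) ^ (1 / p)
/-- The scalar gradient norm `‖∇f‖_{L_p(σ_n)} = ‖(∑_i |∂_i f|²)^{1/2}‖_{L_p(σ_n)}`. -/
def cubeScalGradLp {n : ℕ} (p : ℝ) (f : Cube n → ℂ) : ℝ :=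
  cubeLp p (fun x => Real.sqrt (∑ i, ‖dparC i f x‖ ^ 2))

/-- The length of the discrete gradient at a point. -/
def gradNorm {n : ℕ} [NormedSpace ℝ E] (f : Cube n → E) (x : Cube n) : ℝ :=
  √(∑ i, ‖dparC i f x‖ ^ 2)

/-- The transition kernel of the noise operator with correlation `ρ`. -/
def noiseKernel {n : ℕ} (ρ : ℝ) (x y : Cube n) : ℝ :=
  ∏ i, (1 + ρ * (sgn' (x i) * sgn' (y i))) / 2

/-- The noise operator with correlation `ρ`. -/
def noiseOp {n : ℕ} (ρ : ℝ) (u : Cube n → ℝ) (x : Cube n) : ℝ :=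
  ∑ y, noiseKernel ρ x y * u y

/-! ### Averages -/

section Average

variable {n : ℕ} {u v : Cube n → ℝ}

lemma cubeAvg_real (u : Cube n → ℝ) : cubeAvg u = (2 ^ n : ℝ)⁻¹ * ∑ x, u x := rfl

lemma cubeAvg_add (u v : Cube n → ℝ) :
    cubeAvg (fun x => u x + v x) = cubeAvg u + cubeAvg v := by
  simp only [cubeAvg_real, sum_add_distrib, mul_add]

lemma cubeAvg_sub (u v : Cube n → ℝ) :
    cubeAvg (fun x => u x - v x) = cubeAvg u - cubeAvg v := by
  simp only [cubeAvg_real, sum_sub_distrib, mul_sub]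

lemma cubeAvg_const_mul (c : ℝ) (u : Cube n → ℝ) :
    cubeAvg (fun x => c * u x) = c * cubeAvg u := by
  simp only [cubeAvg_real, ← mul_sum]; ring

lemma cubeAvg_mul_const (c : ℝ) (u : Cube n → ℝ) :
    cubeAvg (fun x => u x * c) = cubeAvg u * c := by
  simp only [cubeAvg_real, ← sum_mul]; ring

lemma cubeAvg_sum {ι : Type*} (s : Finset ι) (u : ι → Cube n → ℝ) :
    cubeAvg (fun x => ∑ i ∈ s, u i x) = ∑ i ∈ s, cubeAvg (u i) := by
  simp only [cubeAvg_real]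
  rw [sum_comm, mul_sum]

lemma cubeAvg_mono (h : ∀ x, u x ≤ v x) : cubeAvg u ≤ cubeAvg v := by
  simp only [cubeAvg_real]
  gcongr with x
  exact h x

lemma cubeAvg_nonneg (h : ∀ x, 0 ≤ u x) : 0 ≤ cubeAvg u := by
  rw [cubeAvg_real]
  have := sum_nonneg fun x (_ : x ∈ univ) => h x
  positivity

lemma sq_cubeAvg_mul_le (u v : Cube n → ℝ) :
    cubeAvg (fun x => u x * v x) ^ 2 ≤
      cubeAvg (fun x => u x ^ 2) * cubeAvg (fun x => v x ^ 2) := by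
  simp only [cubeAvg_real]
  have := sum_mul_sq_le_sq_mul_sq univ u v
  calc _ = ((2 ^ n : ℝ)⁻¹) ^ 2 * (∑ x, u x * v x) ^ 2 := by ring
    _ ≤ ((2 ^ n : ℝ)⁻¹) ^ 2 * ((∑ x, u x ^ 2) * ∑ x, v x ^ 2) := by gcongr
    _ = _ := by ring

lemma cubeAvg_mul_le_Lp_mul_Lq {p q : ℝ} (hpq : p.HolderConjugate q)
    (hu : ∀ x, 0 ≤ u x) (hv : ∀ x, 0 ≤ v x) :
    cubeAvg (fun x => u x * v x) ≤
      cubeAvg (fun x => u x ^ p) ^ (1 / p) * cubeAvg (fun x => v x ^ q) ^ (1 / q) := by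
  have hw : (0 : ℝ) < (2 ^ n : ℝ)⁻¹ := by positivity
  simp only [cubeAvg_real]
  have h := inner_le_Lp_mul_Lq_of_nonneg univ hpq (fun x _ => hu x) (fun x _ => hv x)
  have h1 : 0 ≤ ∑ x, u x ^ p := sum_nonneg fun x _ => rpow_nonneg (hu x) _
  have h2 : 0 ≤ ∑ x, v x ^ q := sum_nonneg fun x _ => rpow_nonneg (hv x) _
  rw [mul_rpow hw.le h1, mul_rpow hw.le h2]
  have h3 : ((2 ^ n : ℝ)⁻¹) ^ (1 / p) * ((2 ^ n : ℝ)⁻¹) ^ (1 / q) = (2 ^ n : ℝ)⁻¹ := by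
    rw [← rpow_add hw, one_div, one_div, hpq.inv_add_inv_eq_one, rpow_one]
  calc _ ≤ (2 ^ n : ℝ)⁻¹ * ((∑ x, u x ^ p) ^ (1 / p) * (∑ x, v x ^ q) ^ (1 / q)) := by gcongr
    _ = _ := by nth_rw 1 [← h3]; ring

/-- Jensen's inequality for powers, on the cube. -/
lemma cubeAvg_rpow_le {r : ℝ} (hr : 1 ≤ r) (hu : ∀ x, 0 ≤ u x) :
    cubeAvg u ^ r ≤ cubeAvg (fun x => u x ^ r) := by
  have h := rpow_arith_mean_le_arith_mean_rpow univ (fun _ : Cube n => (2 ^ n : ℝ)⁻¹) u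
    (fun _ _ => by positivity) (by simp) (fun x _ => hu x) hr
  simpa only [cubeAvg_real, mul_sum] using h

lemma cubeAvg_le_Lp {p : ℝ} (hp : 1 ≤ p) (hu : ∀ x, 0 ≤ u x) :
    cubeAvg u ≤ cubeAvg (fun x => u x ^ p) ^ (1 / p) := by
  have h := cubeAvg_rpow_le hp hu
  have hp0 : 0 < p := by linarith
  have := rpow_le_rpow (rpow_nonneg (cubeAvg_nonneg hu) _) h (by positivity : 0 ≤ 1 / p)
  rwa [← rpow_mul (cubeAvg_nonneg hu), mul_one_div_cancel hp0.ne', rpow_one] at this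

lemma flipC_flipC (i : Fin n) (x : Cube n) : flipC i (flipC i x) = x := by
  simp [flipC]

lemma sum_flipC (i : Fin n) (u : Cube n → ℝ) : ∑ x, u (flipC i x) = ∑ x, u x :=
  Fintype.sum_equiv (Function.Involutive.toPerm _ (flipC_flipC i)) _ _ fun _ => rfl

lemma cubeAvg_flipC (i : Fin n) (u : Cube n → ℝ) :
    cubeAvg (fun x => u (flipC i x)) = cubeAvg u := by
  rw [cubeAvg_real, cubeAvg_real, sum_flipC i u]

lemma sum_cube_succ (u : Cube (n + 1) → ℝ) :
    ∑ x, u x = ∑ x : Cube n, (u (Fin.cons true x) + u (Fin.cons false x)) := by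
  rw [← (Fin.consEquiv fun _ : Fin (n + 1) => Bool).sum_comp, Fintype.sum_prod_type]
  simp [Fin.consEquiv, sum_add_distrib]

lemma cubeAvg_succ (u : Cube (n + 1) → ℝ) :
    cubeAvg u = cubeAvg fun x : Cube n => (u (Fin.cons true x) + u (Fin.cons false x)) / 2 := by
  rw [cubeAvg_real, cubeAvg_real, sum_cube_succ, ← sum_div, pow_succ]
  field_simp

end Average

/-! ### The noise operator -/

section Noise

variable {n : ℕ} {ρ : ℝ}

lemma sgn'_mul_self (b : Bool) : sgn' b * sgn' b = 1 := by
  cases b <;> simp [sgn']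

lemma noiseKernel_symm (ρ : ℝ) (x y : Cube n) : noiseKernel ρ x y = noiseKernel ρ y x := by
  simp only [noiseKernel, mul_comm (sgn' (x _))]

lemma noiseKernel_nonneg (h0 : 0 ≤ ρ) (h1 : ρ ≤ 1) (x y : Cube n) : 0 ≤ noiseKernel ρ x y := by
  refine prod_nonneg fun i _ => ?_
  cases x i <;> cases y i <;> simp [sgn'] <;> linarith

lemma sum_noiseKernel_mul (ρ τ : ℝ) (x y : Cube n) :
    ∑ z, noiseKernel ρ x z * noiseKernel τ z y = noiseKernel (ρ * τ) x y := by
  simp only [noiseKernel, ← prod_mul_distrib]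
  have := prod_univ_sum (fun _ : Fin n => (univ : Finset Bool)) (fun i b =>
    (1 + ρ * (sgn' (x i) * sgn' b)) / 2 * ((1 + τ * (sgn' b * sgn' (y i))) / 2))
  rw [Fintype.piFinset_univ] at this
  rw [← this]
  refine prod_congr rfl fun i _ => ?_
  cases x i <;> cases y i <;> simp [sgn'] <;> ring

lemma sum_noiseKernel (ρ : ℝ) (x : Cube n) : ∑ y, noiseKernel ρ x y = 1 := by
  simp only [noiseKernel]
  have := prod_univ_sum (fun _ : Fin n => (univ : Finset Bool)) (fun i b =>
    (1 + ρ * (sgn' (x i) * sgn' b)) / 2)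
  rw [Fintype.piFinset_univ] at this
  rw [← this]
  refine prod_eq_one fun i _ => ?_
  cases x i <;> simp [sgn'] <;> ring

lemma noiseKernel_one (x y : Cube n) : noiseKernel 1 x y = if x = y then 1 else 0 := by
  split_ifs with h
  · subst h
    simp [noiseKernel, sgn'_mul_self]
  · obtain ⟨i, hi⟩ := Function.ne_iff.1 h
    refine prod_eq_zero (mem_univ i) ?_
    revert hi
    cases x i <;> cases y i <;> simp [sgn']

lemma noiseOp_one (u : Cube n → ℝ) : noiseOp 1 u = u := by
  ext x
  simp [noiseOp, noiseKernel_one]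

lemma noiseOp_zero (u : Cube n → ℝ) (x : Cube n) : noiseOp 0 u x = cubeAvg u := by
  simp [noiseOp, noiseKernel, cubeAvg_real, mul_sum]

lemma noiseOp_noiseOp (ρ τ : ℝ) (u : Cube n → ℝ) :
    noiseOp ρ (noiseOp τ u) = noiseOp (ρ * τ) u := by
  ext x
  simp only [noiseOp, ← sum_noiseKernel_mul, mul_sum, sum_mul]
  rw [sum_comm]
  simp only [mul_assoc]

lemma cubeAvg_mul_noiseOp (ρ : ℝ) (u v : Cube n → ℝ) :
    cubeAvg (fun x => u x * noiseOp ρ v x) = cubeAvg (fun x => noiseOp ρ u x * v x) := by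
  simp only [cubeAvg_real, noiseOp, mul_sum, sum_mul]
  rw [sum_comm]
  simp only [noiseKernel_symm ρ]
  refine sum_congr rfl fun x _ => sum_congr rfl fun y _ => ?_
  rw [noiseKernel_symm ρ x y]
  ring

lemma cubeAvg_noiseOp (ρ : ℝ) (u : Cube n → ℝ) : cubeAvg (noiseOp ρ u) = cubeAvg u := by
  have := cubeAvg_mul_noiseOp ρ (fun _ => 1) u
  simp only [noiseOp, mul_one, one_mul, sum_noiseKernel] at this
  exact this

lemma noiseKernel_cons (ρ : ℝ) (b c : Bool) (x y : Cube n) :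
    noiseKernel ρ (Fin.cons b x : Cube (n + 1)) (Fin.cons c y : Cube (n + 1)) =
      (1 + ρ * (sgn' b * sgn' c)) / 2 * noiseKernel ρ x y := by
  simp only [noiseKernel, Fin.prod_univ_succ, Fin.cons_zero, Fin.cons_succ]

/-- The part of a function that does not depend on the first coordinate. -/
def evenPart (u : Cube (n + 1) → ℝ) (x : Cube n) : ℝ :=
  (u (Fin.cons true x) + u (Fin.cons false x)) / 2

/-- The coefficient of the first coordinate in a function on the cube. -/
def oddPart (u : Cube (n + 1) → ℝ) (x : Cube n) : ℝ :=
  (u (Fin.cons true x) - u (Fin.cons false x)) / 2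

lemma cons_eq_evenPart_add (u : Cube (n + 1) → ℝ) (b : Bool) (x : Cube n) :
    u (Fin.cons b x) = evenPart u x + sgn' b * oddPart u x := by
  cases b <;> simp [evenPart, oddPart, sgn'] <;> ring

lemma noiseOp_cons (ρ : ℝ) (u : Cube (n + 1) → ℝ) (b : Bool) (x : Cube n) :
    noiseOp ρ u (Fin.cons b x) =
      noiseOp ρ (evenPart u) x + sgn' b * (ρ * noiseOp ρ (oddPart u) x) := by
  simp only [noiseOp, sum_cube_succ, noiseKernel_cons, mul_sum, ← sum_add_distrib]
  refine sum_congr rfl fun y _ => ?_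
  cases b <;> simp [evenPart, oddPart, sgn'] <;> ring

/-- Bonami's `L_2 → L_4` hypercontractive inequality. -/
lemma cubeAvg_noiseOp_pow_four_le (hρ : 3 * ρ ^ 2 ≤ 1) (u : Cube n → ℝ) :
    cubeAvg (fun x => noiseOp ρ u x ^ 4) ≤ cubeAvg (fun x => u x ^ 2) ^ 2 := by
  induction n with
  | zero =>
    simp [cubeAvg_real, noiseOp, noiseKernel, ← pow_mul]
  | succ n ih =>
    set a := evenPart u
    set b := oddPart u
    set α := cubeAvg (fun x => a x ^ 2)
    set β := cubeAvg (fun x => b x ^ 2)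
    have hα : 0 ≤ α := cubeAvg_nonneg fun x => sq_nonneg _
    have hβ : 0 ≤ β := cubeAvg_nonneg fun x => sq_nonneg _
    have h2 : cubeAvg (fun x => u x ^ 2) = α + β := by
      rw [cubeAvg_succ, ← cubeAvg_add]
      congr 1; ext x
      simp only [cons_eq_evenPart_add, sgn']
      simp; ring
    have h4 : cubeAvg (fun x => noiseOp ρ u x ^ 4) = cubeAvg (fun x => noiseOp ρ a x ^ 4) +
        6 * ρ ^ 2 * cubeAvg (fun x => noiseOp ρ a x ^ 2 * noiseOp ρ b x ^ 2) +
        ρ ^ 4 * cubeAvg (fun x => noiseOp ρ b x ^ 4) := by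
      rw [cubeAvg_succ, ← cubeAvg_const_mul, ← cubeAvg_const_mul, ← cubeAvg_add, ← cubeAvg_add]
      congr 1; ext x
      simp only [noiseOp_cons, sgn']
      simp [a, b]; ring
    have hm : cubeAvg (fun x => noiseOp ρ a x ^ 2 * noiseOp ρ b x ^ 2) ≤ α * β := by
      refine abs_le_of_sq_le_sq' ?_ (by positivity) |>.2
      refine (sq_cubeAvg_mul_le _ _).trans ?_
      simp only [← pow_mul]
      rw [mul_pow]
      exact mul_le_mul (ih a) (ih b) (cubeAvg_nonneg fun x => by rw [pow_mul]; positivity)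
        (by positivity)
    have hm0 : 0 ≤ cubeAvg (fun x => noiseOp ρ a x ^ 2 * noiseOp ρ b x ^ 2) :=
      cubeAvg_nonneg fun x => by positivity
    have hb0 : 0 ≤ cubeAvg (fun x => noiseOp ρ b x ^ 4) :=
      cubeAvg_nonneg fun x => by positivity
    have hρ4 : ρ ^ 4 ≤ 1 := by nlinarith [sq_nonneg ρ]
    rw [h2, h4]
    have e1 := ih a
    have e2 : ρ ^ 4 * cubeAvg (fun x => noiseOp ρ b x ^ 4) ≤ β ^ 2 :=
      (mul_le_of_le_one_left hb0 hρ4).trans (ih b)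
    have e3 : 6 * ρ ^ 2 * cubeAvg (fun x => noiseOp ρ a x ^ 2 * noiseOp ρ b x ^ 2)
        ≤ 2 * (α * β) := mul_le_mul (by linarith) hm hm0 (by norm_num)
    linarith [show (α + β) ^ 2 = α ^ 2 + 2 * (α * β) + β ^ 2 by ring]

/-- A form of the `L_{4/3} → L_2` hypercontractive inequality, with the `L_{4/3}` norm interpolated
between `L_1` and `L_2`. -/
lemma sq_cubeAvg_mul_noiseOp_third_le {u : Cube n → ℝ} (hu : ∀ x, 0 ≤ u x) :
    cubeAvg (fun x => u x * noiseOp (1 / 3) u x) ^ 2 ≤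
      cubeAvg u ^ 2 * cubeAvg (fun x => u x ^ 2) := by
  set ρ : ℝ := √(1 / 3)
  have hρ : ρ * ρ = 1 / 3 := mul_self_sqrt (by norm_num)
  set v := noiseOp (1 / 3) u
  set ψ := cubeAvg (fun x => u x * v x)
  have hv : v = noiseOp ρ (noiseOp ρ u) := by rw [noiseOp_noiseOp, hρ]
  have hψ : ψ = cubeAvg (fun x => noiseOp ρ u x ^ 2) := by
    simp only [ψ, hv]
    rw [cubeAvg_mul_noiseOp]
    simp only [sq]
  have h4 : cubeAvg (fun x => v x ^ 4) ≤ ψ ^ 2 := by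
    rw [hψ, hv]
    exact cubeAvg_noiseOp_pow_four_le (by rw [sq, hρ]; norm_num) _
  have h1 : ψ ^ 2 ≤ cubeAvg u * cubeAvg (fun x => v x ^ 2 * u x) := by
    have := sq_cubeAvg_mul_le (fun x => √(u x)) (fun x => v x * √(u x))
    simp only [mul_pow, sq_sqrt (hu _)] at this
    convert this using 3
    ext x
    rw [mul_left_comm, mul_self_sqrt (hu x), mul_comm]
  have h2 := sq_cubeAvg_mul_le (fun x => v x ^ 2) u
  simp only [← pow_mul] at h2
  have hu2 : 0 ≤ cubeAvg (fun x => u x ^ 2) := cubeAvg_nonneg fun x => sq_nonneg _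
  have h3 : (ψ ^ 2) ^ 2 ≤ ψ ^ 2 * (cubeAvg u ^ 2 * cubeAvg (fun x => u x ^ 2)) := by
    calc (ψ ^ 2) ^ 2 ≤ (cubeAvg u * cubeAvg (fun x => v x ^ 2 * u x)) ^ 2 := by gcongr
      _ = cubeAvg u ^ 2 * cubeAvg (fun x => v x ^ 2 * u x) ^ 2 := by ring
      _ ≤ cubeAvg u ^ 2 * (ψ ^ 2 * cubeAvg (fun x => u x ^ 2)) := by
        gcongr
        exact h2.trans (by gcongr)
      _ = _ := by ring
  rcases (sq_nonneg ψ).eq_or_lt with h | h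
  · rw [← h]; positivity
  · rw [sq (ψ ^ 2)] at h3
    exact le_of_mul_le_mul_left h3 h

lemma sq_cubeAvg_mul_noiseOp_le (ρ : ℝ) (u : Cube n → ℝ) :
    cubeAvg (fun x => u x * noiseOp ρ u x) ^ 2 ≤
      cubeAvg (fun x => u x ^ 2) * cubeAvg (fun x => u x * noiseOp (ρ ^ 2) u x) := by
  refine (sq_cubeAvg_mul_le _ _).trans_eq ?_
  rw [sq ρ, ← noiseOp_noiseOp, cubeAvg_mul_noiseOp]
  simp only [sq]

lemma cubeAvg_mul_noiseOp_nonneg (h0 : 0 ≤ ρ) (h1 : ρ ≤ 1) {u v : Cube n → ℝ}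
    (hu : ∀ x, 0 ≤ u x) (hv : ∀ x, 0 ≤ v x) :
    0 ≤ cubeAvg (fun x => u x * noiseOp ρ v x) :=
  cubeAvg_nonneg fun x => mul_nonneg (hu x) <| sum_nonneg fun y _ =>
    mul_nonneg (noiseKernel_nonneg h0 h1 x y) (hv y)

lemma cubeAvg_mul_noiseOp_pow_le {u : Cube n → ℝ} (j : ℕ) :
    ∀ ρ : ℝ, 0 ≤ ρ → ρ ≤ 1 → (∀ x, 0 ≤ u x) →
    cubeAvg (fun x => u x * noiseOp ρ u x) ^ 2 ^ j * cubeAvg (fun x => u x ^ 2) ≤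
      cubeAvg (fun x => u x ^ 2) ^ 2 ^ j * cubeAvg (fun x => u x * noiseOp (ρ ^ 2 ^ j) u x) := by
  induction j with
  | zero =>
    intro ρ _ _ _
    simp [mul_comm]
  | succ j ih =>
    intro ρ h0 h1 hu
    have h := ih (ρ ^ 2) (by positivity) (pow_le_one₀ h0 h1) hu
    have hu2 : 0 ≤ cubeAvg (fun x => u x ^ 2) := cubeAvg_nonneg fun x => sq_nonneg _
    have e : (2 : ℕ) ^ (j + 1) = 2 * 2 ^ j := by ring
    rw [e]
    simp only [pow_mul _ 2 (2 ^ j)]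
    calc _ ≤ (cubeAvg (fun x => u x ^ 2) * cubeAvg (fun x => u x * noiseOp (ρ ^ 2) u x)) ^ 2 ^ j *
          cubeAvg (fun x => u x ^ 2) := by
          gcongr
          exact sq_cubeAvg_mul_noiseOp_le ρ u
      _ = cubeAvg (fun x => u x ^ 2) ^ 2 ^ j *
          (cubeAvg (fun x => u x * noiseOp (ρ ^ 2) u x) ^ 2 ^ j * cubeAvg (fun x => u x ^ 2)) := by
        ring
      _ ≤ _ := mul_le_mul_of_nonneg_left h (by positivity)
      _ = _ := by ring

/-- Small-set expansion: a nonnegative function whose `L_1` norm is much smaller than its `L_2` norm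
loses half of its energy after a short time. -/
lemma exists_cubeAvg_mul_noiseOp_le_half {u : Cube n → ℝ} (hu : ∀ x, 0 ≤ u x) {l : ℝ} (hl : 1 ≤ l)
    (h : cubeAvg u ^ 2 * exp (2 * l) ≤ cubeAvg (fun x => u x ^ 2)) :
    ∃ ρ : ℝ, 0 ≤ ρ ∧ ρ ≤ 1 ∧ (1 - ρ) * l ≤ 4 ∧
      cubeAvg (fun x => u x * noiseOp ρ u x) ≤ cubeAvg (fun x => u x ^ 2) / 2 := by
  obtain ⟨j, hj1, hj2⟩ := exists_nat_pow_near hl one_lt_two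
  have hlog : log 3 ≤ 2 := by linarith [log_le_sub_one_of_pos (show (0:ℝ) < 3 by norm_num)]
  have hlog0 : 0 ≤ log 3 := log_nonneg (by norm_num)
  have h2j : (0 : ℝ) < 2 ^ j := by positivity
  set ρ := exp (-(log 3 / 2 ^ j))
  have hρ1 : ρ ≤ 1 := exp_le_one_iff.2 (by simpa using by positivity)
  have hρ : ρ ^ 2 ^ j = 1 / 3 := by
    rw [← exp_nat_mul]
    push_cast
    rw [mul_neg, mul_div_cancel₀ _ h2j.ne', exp_neg, exp_log (by norm_num), one_div]
  refine ⟨ρ, (exp_pos _).le, hρ1, ?_, ?_⟩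
  · have h1 : 1 - ρ ≤ log 3 / 2 ^ j := by linarith [add_one_le_exp (-(log 3 / 2 ^ j))]
    rw [le_div_iff₀ h2j] at h1
    rw [pow_succ] at hj2
    nlinarith
  · set S := cubeAvg (fun x => u x ^ 2)
    set ψ := cubeAvg (fun x => u x * noiseOp ρ u x)
    have hψ0 : 0 ≤ ψ := cubeAvg_mul_noiseOp_nonneg (exp_pos _).le hρ1 hu hu
    have hS0 : 0 ≤ S := cubeAvg_nonneg fun x => sq_nonneg _
    have hp := cubeAvg_mul_noiseOp_pow_le j ρ (exp_pos _).le hρ1 hu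
    rw [hρ] at hp
    set χ := cubeAvg (fun x => u x * noiseOp (1 / 3) u x)
    have h3 : χ ≤ S * exp (-l) := by
      refine abs_le_of_sq_le_sq' ?_ (by positivity) |>.2
      refine (sq_cubeAvg_mul_noiseOp_third_le hu).trans ?_
      rw [mul_pow, sq S, ← exp_nat_mul]
      have : cubeAvg u ^ 2 ≤ S * exp (-(2 * l)) := by
        rw [exp_neg, ← div_eq_mul_inv, le_div_iff₀ (exp_pos _)]; exact h
      push_cast
      rw [show (2 : ℝ) * -l = -(2 * l) by ring]
      nlinarith
    rcases hS0.eq_or_lt with hS | hS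
    · have := sq_cubeAvg_mul_noiseOp_le ρ u
      change ψ ^ 2 ≤ S * _ at this
      rw [← hS, zero_mul] at this
      have : ψ = 0 := by nlinarith
      rw [this, ← hS]; norm_num
    · have h4 : ψ ^ 2 ^ j ≤ (S / 2) ^ 2 ^ j := by
        have h5 : ψ ^ 2 ^ j * S ≤ (S ^ 2 ^ j * exp (-l)) * S := by
          refine hp.trans ?_
          rw [mul_assoc, mul_comm (exp _)]
          gcongr
        refine (le_of_mul_le_mul_right h5 hS).trans ?_
        rw [div_pow, div_eq_mul_inv]
        gcongr
        have h6 : (2 : ℝ) ≤ exp 1 := by linarith [add_one_le_exp (1 : ℝ)]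
        calc exp (-l) ≤ exp (-(2 ^ j)) := by gcongr
          _ = (exp 1 ^ 2 ^ j)⁻¹ := by rw [exp_neg, ← exp_nat_mul]; simp
          _ ≤ _ := by gcongr
      exact le_of_pow_le_pow_left₀ (by positivity) (by positivity) h4

end Noise

/-! ### Gradients and the noise operator -/

section Gradient

variable {n : ℕ} {ρ : ℝ}

lemma dparC_real (i : Fin n) (u : Cube n → ℝ) (x : Cube n) :
    dparC i u x = (u x - u (flipC i x)) / 2 := by
  simp [dparC]; ring

lemma gradNorm_nonneg [NormedSpace ℝ E] (f : Cube n → E) (x : Cube n) : 0 ≤ gradNorm f x :=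
  sqrt_nonneg _

lemma gradNorm_sq_real (u : Cube n → ℝ) (x : Cube n) :
    gradNorm u x ^ 2 = ∑ i, dparC i u x ^ 2 := by
  rw [gradNorm, sq_sqrt (sum_nonneg fun i _ => sq_nonneg _)]
  simp

lemma dparC_zero_cons (u : Cube (n + 1) → ℝ) (b : Bool) (x : Cube n) :
    dparC 0 u (Fin.cons b x) = sgn' b * oddPart u x := by
  have : flipC 0 (Fin.cons b x : Cube (n + 1)) = Fin.cons (!b) x := by
    simp [flipC, Fin.update_cons_zero]
  rw [dparC_real, this]
  cases b <;> simp [oddPart, sgn']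
  ring

lemma dparC_succ_cons (u : Cube (n + 1) → ℝ) (i : Fin n) (b : Bool) (x : Cube n) :
    dparC i.succ u (Fin.cons b x) = dparC i (evenPart u) x + sgn' b * dparC i (oddPart u) x := by
  have : flipC i.succ (Fin.cons b x : Cube (n + 1)) = Fin.cons b (flipC i x) := by
    simp [flipC, Fin.cons_update]
  rw [dparC_real, this, dparC_real, dparC_real, cons_eq_evenPart_add u, cons_eq_evenPart_add u]
  ring

/-- The energy lost under the noise operator is controlled by the Dirichlet form. -/
lemma cubeAvg_sq_sub_mul_noiseOp_le (h0 : 0 ≤ ρ) (h1 : ρ ≤ 1) (u : Cube n → ℝ) :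
    cubeAvg (fun x => u x ^ 2) - cubeAvg (fun x => u x * noiseOp ρ u x) ≤
      (1 - ρ) * cubeAvg (fun x => gradNorm u x ^ 2) := by
  simp only [gradNorm_sq_real]
  induction n with
  | zero => simp [cubeAvg_real, noiseOp, noiseKernel, sq]
  | succ n ih =>
    set a := evenPart u
    set b := oddPart u
    have e1 : cubeAvg (fun x => u x ^ 2) =
        cubeAvg (fun x => a x ^ 2) + cubeAvg (fun x => b x ^ 2) := by
      rw [cubeAvg_succ, ← cubeAvg_add]
      congr 1; ext x
      simp only [cons_eq_evenPart_add, sgn']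
      simp; ring
    have e2 : cubeAvg (fun x => u x * noiseOp ρ u x) =
        cubeAvg (fun x => a x * noiseOp ρ a x) + ρ * cubeAvg (fun x => b x * noiseOp ρ b x) := by
      rw [cubeAvg_succ, ← cubeAvg_const_mul, ← cubeAvg_add]
      congr 1; ext x
      simp only [noiseOp_cons, cons_eq_evenPart_add u, sgn']
      simp [a, b]; ring
    have e3 : cubeAvg (fun x => ∑ i, dparC i u x ^ 2) = cubeAvg (fun x => b x ^ 2) +
        (cubeAvg (fun x => ∑ i, dparC i a x ^ 2) + cubeAvg (fun x => ∑ i, dparC i b x ^ 2)) := by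
      rw [cubeAvg_succ, ← cubeAvg_add, ← cubeAvg_add]
      congr 1; ext x
      simp only [Fin.sum_univ_succ, dparC_zero_cons, dparC_succ_cons, sgn', ← sum_add_distrib]
      have : ∀ s : Fin n → ℝ, ∀ t : Fin n → ℝ, ∑ i, (s i ^ 2 + t i ^ 2) =
          (∑ i, (s i + t i) ^ 2 + ∑ i, (s i - t i) ^ 2) / 2 := fun s t => by
        rw [← sum_add_distrib, sum_div]
        exact sum_congr rfl fun i _ => by ring
      rw [this]
      simp [a, b, ← sub_eq_add_neg]; ring
    rw [e1, e2, e3]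
    have ha := ih a
    have hb := ih b
    have hb0 : 0 ≤ cubeAvg (fun x => ∑ i, dparC i b x ^ 2) :=
      cubeAvg_nonneg fun x => sum_nonneg fun i _ => sq_nonneg _
    have hb1 := mul_le_mul_of_nonneg_left hb h0
    nlinarith [mul_nonneg (sub_nonneg.2 h1) (mul_nonneg (sub_nonneg.2 h1) hb0)]

/-- The variables `x_i y_i - ρ` are centered and orthogonal with variance `1 - ρ ^ 2` under the
noise kernel at `x`. -/
lemma sum_noiseKernel_mul_sq (ρ : ℝ) (x : Cube n) (d : Fin n → ℝ) (c : ℝ) :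
    ∑ y, noiseKernel ρ x y * (c + ∑ i, d i * (sgn' (x i) * sgn' (y i) - ρ)) ^ 2 =
      c ^ 2 + (1 - ρ ^ 2) * ∑ i, d i ^ 2 := by
  induction n generalizing c with
  | zero => simp [noiseKernel]
  | succ n ih =>
    rw [← Fin.cons_self_tail x]
    simp only [sum_cube_succ, noiseKernel_cons, Fin.sum_univ_succ, Fin.cons_zero, Fin.cons_succ,
      sum_add_distrib, ← add_assoc, mul_assoc, ← mul_sum, ih (Fin.tail x) fun i => d i.succ]
    cases x 0 <;> simp [sgn'] <;> ring

/-- The derivative of the noise kernel in the `i`-th factor. -/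
def noiseKernelDeriv (ρ : ℝ) (i : Fin n) (x y : Cube n) : ℝ :=
  (∏ j ∈ univ.erase i, (1 + ρ * (sgn' (x j) * sgn' (y j))) / 2) * (sgn' (x i) * sgn' (y i) / 2)

lemma hasDerivAt_noiseKernel (ρ : ℝ) (x y : Cube n) :
    HasDerivAt (fun τ => noiseKernel τ x y) (∑ i, noiseKernelDeriv ρ i x y) ρ := by
  have h := HasDerivAt.fun_finsetProd (u := univ) (x := ρ)
    (f := fun i τ => (1 + τ * (sgn' (x i) * sgn' (y i))) / 2)
    (f' := fun i => sgn' (x i) * sgn' (y i) / 2) fun i _ => by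
      simpa using (((hasDerivAt_id ρ).mul_const (sgn' (x i) * sgn' (y i))).const_add 1).div_const 2
  simp only [smul_eq_mul] at h
  exact h

lemma noiseKernelDeriv_flipC (ρ : ℝ) (i : Fin n) (x y : Cube n) :
    noiseKernelDeriv ρ i (flipC i x) y = -noiseKernelDeriv ρ i x y := by
  have h1 : sgn' (flipC i x i) = -sgn' (x i) := by
    cases h : x i <;> simp [flipC, sgn', h]
  have h2 : ∀ j ∈ univ.erase i, (1 + ρ * (sgn' (flipC i x j) * sgn' (y j))) / 2 =
      (1 + ρ * (sgn' (x j) * sgn' (y j))) / 2 := fun j hj => by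
    simp [flipC, Function.update_of_ne (ne_of_mem_erase hj)]
  rw [noiseKernelDeriv, noiseKernelDeriv, prod_congr rfl h2, h1]
  ring

lemma noiseKernelDeriv_eq (h : ρ ^ 2 < 1) (i : Fin n) (x y : Cube n) :
    noiseKernelDeriv ρ i x y =
      noiseKernel ρ x y * (sgn' (x i) * sgn' (y i) - ρ) / (1 - ρ ^ 2) := by
  rw [eq_div_iff (by linarith), noiseKernel, ← mul_prod_erase _ _ (mem_univ i), noiseKernelDeriv]
  have : (sgn' (x i) * sgn' (y i)) ^ 2 = 1 := by
    rw [sq, mul_mul_mul_comm, sgn'_mul_self, sgn'_mul_self, one_mul]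
  set s := sgn' (x i) * sgn' (y i)
  set P := ∏ j ∈ univ.erase i, (1 + ρ * (sgn' (x j) * sgn' (y j))) / 2
  linear_combination (-(P * ρ) / 2) * this

lemma sum_mul_noiseKernelDeriv (ρ : ℝ) (i : Fin n) (f : Cube n → ℝ) (y : Cube n) :
    ∑ x, f x * noiseKernelDeriv ρ i x y = ∑ x, dparC i f x * noiseKernelDeriv ρ i x y := by
  have h := sum_flipC i fun x => f x * noiseKernelDeriv ρ i x y
  simp only [noiseKernelDeriv_flipC] at h
  simp only [dparC_real, sub_div, sub_mul, sum_sub_distrib]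
  simp only [div_mul_eq_mul_div, ← sum_div, mul_neg, sum_neg_distrib] at h ⊢
  linarith

lemma hasDerivAt_cubeAvg_mul_noiseOp (f g : Cube n → ℝ) (h : ρ ^ 2 < 1) :
    HasDerivAt (fun τ => cubeAvg fun x => f x * noiseOp τ g x)
      (cubeAvg fun x => (∑ y, noiseKernel ρ x y *
        (g y * ∑ i, dparC i f x * (sgn' (x i) * sgn' (y i) - ρ))) / (1 - ρ ^ 2)) ρ := by
  have h1 : HasDerivAt (fun τ => cubeAvg fun x => f x * noiseOp τ g x)
      (cubeAvg fun x => f x * ∑ y, (∑ i, noiseKernelDeriv ρ i x y) * g y) ρ := by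
    simp only [cubeAvg_real, noiseOp]
    exact (HasDerivAt.fun_sum fun x _ => (HasDerivAt.fun_sum fun y _ =>
      (hasDerivAt_noiseKernel ρ x y).mul_const (g y)).const_mul (f x)).const_mul _
  convert h1 using 1
  have e : ∀ a : Cube n → Cube n → Fin n → ℝ,
      ∑ x, ∑ y, ∑ i, a x y i = ∑ y, ∑ i, ∑ x, a x y i := fun a => by
    rw [sum_comm]; exact sum_congr rfl fun y _ => sum_comm
  rw [cubeAvg_real, cubeAvg_real]
  congr 1
  calc _ = ∑ x, ∑ y, ∑ i, dparC i f x * noiseKernelDeriv ρ i x y * g y := by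
        simp only [mul_sum, sum_div]
        refine sum_congr rfl fun x _ => sum_congr rfl fun y _ => sum_congr rfl fun i _ => ?_
        rw [noiseKernelDeriv_eq h]; ring
    _ = ∑ x, ∑ y, ∑ i, f x * noiseKernelDeriv ρ i x y * g y := by
        rw [e, e]
        refine sum_congr rfl fun y _ => sum_congr rfl fun i _ => ?_
        rw [← sum_mul, ← sum_mul, sum_mul_noiseKernelDeriv ρ i f y]
    _ = _ := by simp only [mul_sum, sum_mul, mul_assoc]

lemma sum_noiseKernel_mul_le (h0 : 0 < ρ) (h1 : ρ < 1) (f g : Cube n → ℝ) (x : Cube n) :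
    (∑ y, noiseKernel ρ x y * (g y * ∑ i, dparC i f x * (sgn' (x i) * sgn' (y i) - ρ))) /
      (1 - ρ ^ 2) ≤ gradNorm f x * √(noiseOp ρ (fun y => g y ^ 2) x) / √(1 - ρ) := by
  have hk := noiseKernel_nonneg h0.le h1.le x
  set W := ∑ y, noiseKernel ρ x y * (g y * ∑ i, dparC i f x * (sgn' (x i) * sgn' (y i) - ρ))
  have hρ : 0 < 1 - ρ ^ 2 := by nlinarith
  have hT : 0 ≤ noiseOp ρ (fun y => g y ^ 2) x :=
    sum_nonneg fun y _ => mul_nonneg (hk y) (sq_nonneg _)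
  have hB := sum_noiseKernel_mul_sq ρ x (fun i => dparC i f x) 0
  simp only [zero_add, ne_eq, OfNat.ofNat_ne_zero, not_false_eq_true, zero_pow] at hB
  have hW : W ^ 2 ≤ noiseOp ρ (fun y => g y ^ 2) x * ((1 - ρ ^ 2) * gradNorm f x ^ 2) := by
    rw [gradNorm_sq_real, ← hB, noiseOp]
    have := sum_mul_sq_le_sq_mul_sq univ (fun y => √(noiseKernel ρ x y) * g y) (fun y =>
      √(noiseKernel ρ x y) * ∑ i, dparC i f x * (sgn' (x i) * sgn' (y i) - ρ))
    simp only [mul_pow, sq_sqrt (hk _)] at this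
    refine le_trans (le_of_eq ?_) this
    congr 1
    refine sum_congr rfl fun y _ => ?_
    rw [mul_mul_mul_comm, mul_self_sqrt (hk y)]
  have hW' : W ≤ gradNorm f x * √(noiseOp ρ (fun y => g y ^ 2) x) * √(1 - ρ ^ 2) := by
    have hG := gradNorm_nonneg f x
    refine (abs_le_of_sq_le_sq' ?_ (by positivity)).2
    rw [mul_pow, mul_pow, sq_sqrt hT, sq_sqrt hρ.le]
    linarith
  have hG := gradNorm_nonneg f x
  calc W / (1 - ρ ^ 2)
      ≤ gradNorm f x * √(noiseOp ρ (fun y => g y ^ 2) x) * √(1 - ρ ^ 2) / (1 - ρ ^ 2) := by gcongr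
    _ = gradNorm f x * √(noiseOp ρ (fun y => g y ^ 2) x) / √(1 - ρ ^ 2) := by
      rw [mul_div_assoc, sqrt_div_self', mul_one_div]
    _ ≤ _ := by
      have : 0 < 1 - ρ := by linarith
      gcongr
      nlinarith

/-- Dual form of the estimate `‖f - T_ρ f‖ ≤ C √(1 - ρ) ‖∇f‖`. -/
lemma cubeAvg_mul_sub_mul_noiseOp_le (h0 : 0 ≤ ρ) (h1 : ρ ≤ 1) (f g : Cube n → ℝ) {N : ℝ}
    (hN : ∀ τ : ℝ, 0 < τ → τ < 1 →
      cubeAvg (fun x => gradNorm f x * √(noiseOp τ (fun y => g y ^ 2) x)) ≤ N) :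
    cubeAvg (fun x => f x * g x) - cubeAvg (fun x => f x * noiseOp ρ g x) ≤ 2 * N * √(1 - ρ) := by
  set φ : ℝ → ℝ := fun τ => cubeAvg fun x => f x * noiseOp τ g x
  have hφc : Continuous φ := by
    simp only [φ, cubeAvg_real, noiseOp, noiseKernel]
    fun_prop
  have hd : ∀ τ ∈ interior (Set.Icc (0 : ℝ) 1), ∃ D ≤ N / √(1 - τ), HasDerivAt φ D τ := by
    intro τ hτ
    rw [interior_Icc] at hτ
    refine ⟨_, ?_, hasDerivAt_cubeAvg_mul_noiseOp f g (by nlinarith [hτ.1, hτ.2])⟩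
    refine (cubeAvg_mono fun x => sum_noiseKernel_mul_le hτ.1 hτ.2 f g x).trans ?_
    simp only [div_eq_mul_inv]
    rw [cubeAvg_mul_const]
    gcongr
    exact hN τ hτ.1 hτ.2
  have hs : ∀ τ ∈ interior (Set.Icc (0 : ℝ) 1),
      HasDerivAt (fun τ => -(2 * N * √(1 - τ))) (N / √(1 - τ)) τ := by
    intro τ hτ
    rw [interior_Icc] at hτ
    have hpos : 0 < √(1 - τ) := sqrt_pos.2 (by linarith [hτ.2])
    have h := ((((hasDerivAt_id' τ).const_sub 1).sqrt (by linarith [hτ.2])).const_mul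
      (2 * N)).fun_neg
    exact h.congr_deriv (by field_simp)
  have hmono : MonotoneOn (fun τ => -(2 * N * √(1 - τ)) - φ τ) (Set.Icc 0 1) := by
    refine monotoneOn_of_deriv_nonneg (convex_Icc 0 1) (by fun_prop) ?_ ?_
    · intro τ hτ
      obtain ⟨D, -, hD⟩ := hd τ hτ
      exact ((hs τ hτ).sub hD).differentiableAt.differentiableWithinAt
    · intro τ hτ
      obtain ⟨D, hDN, hD⟩ := hd τ hτ
      rw [((hs τ hτ).fun_sub hD).deriv]
      linarith
  have := hmono ⟨h0, h1⟩ ⟨zero_le_one, le_rfl⟩ h1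
  simp only [φ, noiseOp_one, sub_self, sqrt_zero, mul_zero] at this
  linarith

/-- The `L_1` Poincaré inequality for real functions. -/
lemma cubeAvg_abs_sub_cubeAvg_le (f : Cube n → ℝ) :
    cubeAvg (fun x => |f x - cubeAvg f|) ≤ 2 * cubeAvg (gradNorm f) := by
  set m := cubeAvg f
  set g : Cube n → ℝ := fun x => SignType.sign (f x - m)
  have hg : ∀ x, g x ^ 2 ≤ 1 := fun x => by
    simp only [g]
    cases SignType.sign (f x - m) <;> simp
  have h := cubeAvg_mul_sub_mul_noiseOp_le le_rfl zero_le_one f g (N := cubeAvg (gradNorm f)) ?_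
  · simp only [noiseOp_zero, sub_zero, sqrt_one, mul_one] at h
    refine le_trans (le_of_eq ?_) h
    rw [cubeAvg_mul_const, ← cubeAvg_const_mul, ← cubeAvg_sub]
    congr 1; ext x
    rw [← self_mul_sign]
    simp only [g, m]; ring
  · intro τ hτ0 hτ1
    refine cubeAvg_mono fun x => mul_le_of_le_one_right (gradNorm_nonneg f x) ?_
    rw [sqrt_le_one]
    refine (sum_le_sum fun y _ => mul_le_of_le_one_right
      (noiseKernel_nonneg hτ0.le hτ1.le x y) (hg y)).trans_eq (sum_noiseKernel τ x)

end Gradient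

/-! ### Energy estimates for powers -/

section Powers

variable {n : ℕ} {ρ p : ℝ}

lemma sub_one_mul_sq_rpow_sub_le (hp : 1 < p) (hp2 : p ≤ 2) {a b : ℝ} (ha : 0 ≤ a) (hb : 0 ≤ b) :
    (p - 1) * (a ^ (p / 2) - b ^ (p / 2)) ^ 2 ≤ (a - b) * (a ^ (p - 1) - b ^ (p - 1)) := by
  wlog hab : b ≤ a generalizing a b
  · have := this hb ha (le_of_not_ge hab)
    nlinarith
  rcases ha.eq_or_lt with rfl | ha'
  · obtain rfl : b = 0 := le_antisymm hab hb
    simp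
  obtain ⟨t, rfl⟩ : ∃ t, b = a * t := ⟨b / a, by field_simp⟩
  have ht0 : 0 ≤ t := nonneg_of_mul_nonneg_right hb ha'
  have ht1 : t ≤ 1 := by nlinarith
  have h1 : t ^ (p - 1) ≤ 1 + (p - 1) * (t - 1) := by
    have := rpow_one_add_le_one_add_mul_self (s := t - 1) (p := p - 1) (by linarith)
      (by linarith) (by linarith)
    rwa [add_sub_cancel] at this
  have h2 : t ≤ t ^ (p / 2) := by
    simpa using rpow_le_rpow_of_exponent_ge_of_imp ht0 ht1 (show p / 2 ≤ 1 by linarith)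
      (fun _ h => by linarith)
  have h3 : t ^ (p / 2) ≤ 1 := rpow_le_one ht0 ht1 (by linarith)
  have h4 : (1 - t ^ (p / 2)) ^ 2 ≤ (1 - t) ^ 2 := by
    apply pow_le_pow_left₀ <;> linarith
  have e1 : (a ^ (p / 2)) ^ 2 = a * a ^ (p - 1) := by
    rw [← rpow_mul_natCast ha]
    nth_rw 2 [← rpow_one a]
    rw [← rpow_add ha']; congr 1; push_cast; ring
  rw [mul_rpow ha ht0, mul_rpow ha ht0]
  have h5 : (p - 1) * (1 - t ^ (p / 2)) ^ 2 ≤ (1 - t) * (1 - t ^ (p - 1)) := by nlinarith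
  have h6 := mul_le_mul_of_nonneg_left h5 (sq_nonneg (a ^ (p / 2)))
  calc _ = (a ^ (p / 2)) ^ 2 * ((p - 1) * (1 - t ^ (p / 2)) ^ 2) := by ring
    _ ≤ _ := h6
    _ = _ := by rw [e1]; ring

lemma sq_rpow_sub_le (hp : 2 ≤ p) {a b : ℝ} (ha : 0 ≤ a) (hb : 0 ≤ b) :
    (a ^ (p / 2) - b ^ (p / 2)) ^ 2 ≤
      (p / 2) ^ 2 * ((a ^ (p - 2) + b ^ (p - 2)) * (a - b) ^ 2) := by
  wlog hab : b ≤ a generalizing a b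
  · have := this hb ha (le_of_not_ge hab)
    nlinarith
  rcases ha.eq_or_lt with rfl | ha'
  · obtain rfl : b = 0 := le_antisymm hab hb
    simp
  have hb2 : 0 ≤ b ^ (p - 2) := rpow_nonneg hb _
  suffices h : (a ^ (p / 2) - b ^ (p / 2)) ^ 2 ≤ (p / 2) ^ 2 * (a ^ (p - 2) * (a - b) ^ 2) by
    refine h.trans ?_
    gcongr
    linarith
  obtain ⟨t, rfl⟩ : ∃ t, b = a * t := ⟨b / a, by field_simp⟩
  have ht0 : 0 ≤ t := nonneg_of_mul_nonneg_right hb ha'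
  have ht1 : t ≤ 1 := by nlinarith
  have h1 : 1 + p / 2 * (t - 1) ≤ t ^ (p / 2) := by
    have := one_add_mul_self_le_rpow_one_add (s := t - 1) (p := p / 2) (by linarith) (by linarith)
    rwa [add_sub_cancel] at this
  have h3 : t ^ (p / 2) ≤ 1 := rpow_le_one ht0 ht1 (by linarith)
  have h4 : (1 - t ^ (p / 2)) ^ 2 ≤ (p / 2 * (1 - t)) ^ 2 := by
    apply pow_le_pow_left₀ <;> linarith
  have e1 : (a ^ (p / 2)) ^ 2 = a ^ (p - 2) * a ^ 2 := by
    rw [← rpow_mul_natCast ha, ← rpow_natCast a 2, ← rpow_add ha']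
    congr 1; push_cast; ring
  rw [mul_rpow ha ht0]
  have h6 := mul_le_mul_of_nonneg_left h4 (sq_nonneg (a ^ (p / 2)))
  calc _ = (a ^ (p / 2)) ^ 2 * (1 - t ^ (p / 2)) ^ 2 := by ring
    _ ≤ _ := h6
    _ = _ := by rw [e1]; ring

lemma cubeAvg_mul_sub_mul_noiseOp_eq (ρ : ℝ) (u v : Cube n → ℝ) :
    cubeAvg (fun x => u x * v x) - cubeAvg (fun x => u x * noiseOp ρ v x) =
      cubeAvg (fun x => ∑ y, noiseKernel ρ x y * ((u x - u y) * (v x - v y))) / 2 := by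
  have e1 : cubeAvg (fun x => ∑ y, noiseKernel ρ x y * (u x * v x)) =
      cubeAvg (fun x => u x * v x) := by
    simp only [← sum_mul, sum_noiseKernel, one_mul]
  have e2 : cubeAvg (fun x => ∑ y, noiseKernel ρ x y * (u y * v y)) =
      cubeAvg (fun x => u x * v x) := cubeAvg_noiseOp ρ fun y => u y * v y
  have e3 : cubeAvg (fun x => ∑ y, noiseKernel ρ x y * (u x * v y)) =
      cubeAvg (fun x => u x * noiseOp ρ v x) := by
    simp only [noiseOp, mul_sum, mul_left_comm]
  have e4 : cubeAvg (fun x => ∑ y, noiseKernel ρ x y * (u y * v x)) =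
      cubeAvg (fun x => u x * noiseOp ρ v x) := by
    rw [cubeAvg_mul_noiseOp]
    simp only [noiseOp, sum_mul, mul_assoc]
  have : cubeAvg (fun x => ∑ y, noiseKernel ρ x y * ((u x - u y) * (v x - v y))) =
      cubeAvg (fun x => ∑ y, noiseKernel ρ x y * (u x * v x)) +
      cubeAvg (fun x => ∑ y, noiseKernel ρ x y * (u y * v y)) -
      cubeAvg (fun x => ∑ y, noiseKernel ρ x y * (u x * v y)) -
      cubeAvg (fun x => ∑ y, noiseKernel ρ x y * (u y * v x)) := by
    rw [← cubeAvg_add, ← cubeAvg_sub, ← cubeAvg_sub]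
    congr 1; ext x
    rw [← sum_add_distrib, ← sum_sub_distrib, ← sum_sub_distrib]
    exact sum_congr rfl fun y _ => by ring
  rw [this, e1, e2, e3, e4]
  ring

/-- The Stroock–Varopoulos inequality for the noise operator. -/
lemma stroock_varopoulos (hp : 1 < p) (hp2 : p ≤ 2) (h0 : 0 ≤ ρ) (h1 : ρ ≤ 1) {g : Cube n → ℝ}
    (hg : ∀ x, 0 ≤ g x) :
    (p - 1) * (cubeAvg (fun x => (g x ^ (p / 2)) ^ 2) -
      cubeAvg (fun x => g x ^ (p / 2) * noiseOp ρ (fun y => g y ^ (p / 2)) x)) ≤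
    cubeAvg (fun x => g x * g x ^ (p - 1)) -
      cubeAvg (fun x => g x * noiseOp ρ (fun y => g y ^ (p - 1)) x) := by
  simp only [sq, cubeAvg_mul_sub_mul_noiseOp_eq]
  rw [← mul_div_assoc, ← cubeAvg_const_mul]
  gcongr
  refine cubeAvg_mono fun x => ?_
  rw [mul_sum]
  refine sum_le_sum fun y _ => ?_
  rw [mul_left_comm, ← sq]
  exact mul_le_mul_of_nonneg_left (sub_one_mul_sq_rpow_sub_le hp hp2 (hg x) (hg y))
    (noiseKernel_nonneg h0 h1 x y)

lemma mul_rpow_sub_one_self (hp : p ≠ 0) {a : ℝ} (ha : 0 ≤ a) : a * a ^ (p - 1) = a ^ p := by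
  rcases ha.eq_or_lt with rfl | h
  · rw [zero_rpow hp, zero_mul]
  · nth_rw 1 [← rpow_one a]
    rw [← rpow_add h, add_sub_cancel]

lemma cubeAvg_energy_rpow_le_of_le_two (hp : 1 < p) (hp2 : p ≤ 2) (h0 : 0 ≤ ρ) (h1 : ρ ≤ 1)
    {g : Cube n → ℝ} (hg : ∀ x, 0 ≤ g x) :
    (p - 1) * (cubeAvg (fun x => (g x ^ (p / 2)) ^ 2) -
      cubeAvg (fun x => g x ^ (p / 2) * noiseOp ρ (fun y => g y ^ (p / 2)) x)) ≤
    2 * (cubeAvg (fun x => gradNorm g x ^ p) ^ (1 / p) *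
      (cubeAvg (fun x => g x ^ p) ^ (1 / p)) ^ (p - 1)) * √(1 - ρ) := by
  refine (stroock_varopoulos hp hp2 h0 h1 hg).trans ?_
  refine cubeAvg_mul_sub_mul_noiseOp_le h0 h1 _ _ fun τ hτ0 hτ1 => ?_
  have hpq := Real.HolderConjugate.conjExponent hp
  set q := p.conjExponent
  have hq : q = p / (p - 1) := rfl
  have hq2 : 1 ≤ q / 2 := by
    rw [hq, div_div, one_le_div (by linarith)]; linarith
  have hk := noiseKernel_nonneg (n := n) hτ0.le hτ1.le
  have hT : ∀ x, 0 ≤ noiseOp τ (fun y => (g y ^ (p - 1)) ^ 2) x := fun x =>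
    sum_nonneg fun y _ => mul_nonneg (hk x y) (sq_nonneg _)
  refine (cubeAvg_mul_le_Lp_mul_Lq hpq (gradNorm_nonneg g) fun x => sqrt_nonneg _).trans ?_
  have hGp : 0 ≤ cubeAvg (fun x => gradNorm g x ^ p) :=
    cubeAvg_nonneg fun x => rpow_nonneg (gradNorm_nonneg g x) _
  gcongr
  have hgp : 0 ≤ cubeAvg (fun x => g x ^ p) := cubeAvg_nonneg fun x => rpow_nonneg (hg x) _
  rw [← rpow_mul hgp, show 1 / p * (p - 1) = 1 / q by rw [hq, one_div_div]; ring]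
  have hq0 : 0 ≤ 1 / q := one_div_nonneg.2 (by linarith)
  refine rpow_le_rpow (cubeAvg_nonneg fun x => by positivity) ?_ hq0
  rw [← cubeAvg_noiseOp τ fun x => g x ^ p]
  refine cubeAvg_mono fun x => ?_
  rw [sqrt_eq_rpow, ← rpow_mul (hT x), show 1 / 2 * q = q / 2 by ring]
  refine (rpow_arith_mean_le_arith_mean_rpow univ _ _ (fun y _ => hk x y) (sum_noiseKernel τ x)
    (fun y _ => sq_nonneg _) hq2).trans_eq ?_
  refine sum_congr rfl fun y _ => ?_
  congr 1
  rw [← rpow_natCast, ← rpow_mul (hg y), ← rpow_mul (hg y), hq]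
  congr 1
  have : p - 1 ≠ 0 := by linarith
  push_cast
  field_simp

lemma cubeAvg_energy_rpow_le_of_two_lt (hp : 2 < p) (h0 : 0 ≤ ρ) (h1 : ρ ≤ 1)
    {g : Cube n → ℝ} (hg : ∀ x, 0 ≤ g x) :
    cubeAvg (fun x => (g x ^ (p / 2)) ^ 2) -
      cubeAvg (fun x => g x ^ (p / 2) * noiseOp ρ (fun y => g y ^ (p / 2)) x) ≤
    (1 - ρ) * (p ^ 2 / 2 * ((cubeAvg (fun x => gradNorm g x ^ p) ^ (1 / p)) ^ 2 *
      (cubeAvg (fun x => g x ^ p) ^ (1 / p)) ^ (p - 2))) := by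
  refine (cubeAvg_sq_sub_mul_noiseOp_le h0 h1 fun x => g x ^ (p / 2)).trans ?_
  have hρ : 0 ≤ 1 - ρ := by linarith
  gcongr
  have hp0 : 0 < p := by linarith
  have hp2 : 0 < p - 2 := by linarith
  have e1 : cubeAvg (fun x => gradNorm (fun x => g x ^ (p / 2)) x ^ 2) ≤
      p ^ 2 / 2 * cubeAvg (fun x => gradNorm g x ^ 2 * g x ^ (p - 2)) := by
    simp only [gradNorm_sq_real, sum_mul]
    rw [cubeAvg_sum, cubeAvg_sum, mul_sum]
    refine sum_le_sum fun i _ => ?_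
    have hsymm : cubeAvg (fun x => dparC i g x ^ 2 * g (flipC i x) ^ (p - 2)) =
        cubeAvg (fun x => dparC i g x ^ 2 * g x ^ (p - 2)) := by
      rw [← cubeAvg_flipC i]
      congr 1; ext x
      rw [dparC_real, dparC_real, flipC_flipC]; ring
    calc _ ≤ cubeAvg (fun x => (p / 2) ^ 2 * (dparC i g x ^ 2 * g x ^ (p - 2) +
          dparC i g x ^ 2 * g (flipC i x) ^ (p - 2))) := by
          refine cubeAvg_mono fun x => ?_
          have := sq_rpow_sub_le hp.le (hg x) (hg (flipC i x))
          rw [dparC_real, dparC_real]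
          nlinarith
      _ = _ := by rw [cubeAvg_const_mul, cubeAvg_add, hsymm]; ring
  refine e1.trans ?_
  gcongr
  have hpq : (p / 2).HolderConjugate (p / (p - 2)) := by
    rw [holderConjugate_iff]
    constructor
    · linarith
    · field_simp; ring
  refine (cubeAvg_mul_le_Lp_mul_Lq hpq (fun x => sq_nonneg (gradNorm g x))
    fun x => rpow_nonneg (hg x) _).trans_eq ?_
  have hGp : 0 ≤ cubeAvg (fun x => gradNorm g x ^ p) :=
    cubeAvg_nonneg fun x => rpow_nonneg (gradNorm_nonneg g x) _
  have hgp : 0 ≤ cubeAvg (fun x => g x ^ p) := cubeAvg_nonneg fun x => rpow_nonneg (hg x) _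
  rw [← rpow_mul_natCast hGp, ← rpow_mul hgp]
  have e2 : ∀ x, (gradNorm g x ^ 2) ^ (p / 2) = gradNorm g x ^ p := fun x => by
    rw [← rpow_natCast, ← rpow_mul (gradNorm_nonneg g x)]; congr 1; push_cast; ring
  have e3 : ∀ x, (g x ^ (p - 2)) ^ (p / (p - 2)) = g x ^ p := fun x => by
    rw [← rpow_mul (hg x)]; congr 1; field_simp
  simp only [e2, e3]
  congr 2
  · push_cast; field_simp
  · field_simp

/-- An `L_p` logarithmic Sobolev inequality: if the `L_1` norm of `g ≥ 0` is much smaller than its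
`L_p` norm, then the Poincaré inequality improves accordingly. -/
lemma exists_Lp_mul_sqrt_le (hp : 1 < p) :
    ∃ C : ℝ, 0 < C ∧ ∀ (n : ℕ) (g : Cube n → ℝ) (l : ℝ), (∀ x, 0 ≤ g x) → 1 ≤ l →
      cubeAvg g * exp (2 * l) ≤ cubeAvg (fun x => g x ^ p) ^ (1 / p) →
      cubeAvg (fun x => g x ^ p) ^ (1 / p) * √l ≤
        C * cubeAvg (fun x => gradNorm g x ^ p) ^ (1 / p) := by
  refine ⟨max (8 / (p - 1)) (2 * p), lt_max_of_lt_right (by linarith), ?_⟩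
  intro n g l hg hl h
  have hp0 : 0 < p := by linarith
  have hp1 : 0 < p - 1 := by linarith
  have hgp : 0 ≤ cubeAvg (fun x => g x ^ p) := cubeAvg_nonneg fun x => rpow_nonneg (hg x) _
  set F := cubeAvg (fun x => g x ^ p) ^ (1 / p) with hF
  set A := cubeAvg (fun x => gradNorm g x ^ p) ^ (1 / p)
  have hF0 : 0 ≤ F := by positivity
  have hA0 : 0 ≤ A :=
    rpow_nonneg (cubeAvg_nonneg fun x => rpow_nonneg (gradNorm_nonneg g x) _) _
  have hFp : cubeAvg (fun x => g x ^ p) = F ^ p := by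
    rw [hF, ← rpow_mul hgp, one_div_mul_cancel hp0.ne', rpow_one]
  rcases hF0.eq_or_lt with hF0' | hFpos
  · rw [← hF0', zero_mul]; positivity
  have hsq : ∀ x, (g x ^ (p / 2)) ^ 2 = g x ^ p := fun x => by
    rw [← rpow_mul_natCast (hg x)]; congr 1; push_cast; ring
  have hu2 : cubeAvg (fun x => (g x ^ (p / 2)) ^ 2) = F ^ p := by simp only [hsq, hFp]
  have hgp1 : cubeAvg (fun x => g x ^ (p - 1)) ≤ F ^ (p - 1) := by
    have := cubeAvg_le_Lp (p := p / (p - 1)) (by rw [one_le_div hp1]; linarith)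
      (fun x => rpow_nonneg (hg x) (p - 1))
    refine this.trans_eq ?_
    rw [hF, ← rpow_mul hgp]
    congr 1
    · congr 1; ext x
      rw [← rpow_mul (hg x)]; congr 1; field_simp
    · field_simp
  have hu1 : cubeAvg (fun x => g x ^ (p / 2)) ^ 2 ≤ cubeAvg g * F ^ (p - 1) := by
    have := sq_cubeAvg_mul_le (fun x => g x ^ (1 / 2 : ℝ)) (fun x => g x ^ ((p - 1) / 2))
    have e1 : ∀ x, g x ^ (1 / 2 : ℝ) * g x ^ ((p - 1) / 2) = g x ^ (p / 2) := fun x => by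
      rw [← rpow_add_of_nonneg (hg x) (by norm_num) (by linarith)]; congr 1; ring
    have e2 : ∀ x, (g x ^ (1 / 2 : ℝ)) ^ 2 = g x := fun x => by
      rw [← rpow_mul_natCast (hg x)]; norm_num
    have e3 : ∀ x, (g x ^ ((p - 1) / 2)) ^ 2 = g x ^ (p - 1) := fun x => by
      rw [← rpow_mul_natCast (hg x)]; congr 1; push_cast; ring
    simp only [e1, e2, e3] at this
    exact this.trans (mul_le_mul_of_nonneg_left hgp1 (cubeAvg_nonneg hg))
  have hsmall : cubeAvg (fun x => g x ^ (p / 2)) ^ 2 * exp (2 * l) ≤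
      cubeAvg (fun x => (g x ^ (p / 2)) ^ 2) := by
    rw [hu2, ← mul_rpow_sub_one_self hp0.ne' hF0]
    calc _ ≤ cubeAvg g * F ^ (p - 1) * exp (2 * l) := by gcongr
      _ = cubeAvg g * exp (2 * l) * F ^ (p - 1) := by ring
      _ ≤ _ := by gcongr
  obtain ⟨ρ, h0, h1, hρl, hhalf⟩ := exists_cubeAvg_mul_noiseOp_le_half
    (fun x => rpow_nonneg (hg x) (p / 2)) hl hsmall
  rw [hu2] at hhalf
  have hl0 : 0 ≤ l := by linarith
  have hρ0 : 0 ≤ 1 - ρ := by linarith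
  rcases le_or_gt p 2 with hp2 | hp2
  · have hE := cubeAvg_energy_rpow_le_of_le_two hp hp2 h0 h1 hg
    rw [hu2] at hE
    have hE' : (p - 1) * (F ^ p / 2) ≤ 2 * (A * F ^ (p - 1)) * √(1 - ρ) :=
      (mul_le_mul_of_nonneg_left (by linarith) hp1.le).trans hE
    rw [← mul_rpow_sub_one_self hp0.ne' hF0] at hE'
    have hFq : 0 < F ^ (p - 1) := by positivity
    have hE2 : (p - 1) * F ≤ 4 * A * √(1 - ρ) := by
      refine le_of_mul_le_mul_right ?_ hFq
      linarith
    have hs : √(1 - ρ) * √l ≤ 2 := by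
      rw [← sqrt_mul hρ0, sqrt_le_left (by norm_num)]; linarith
    have hE3 : F * √l ≤ 8 / (p - 1) * A := by
      rw [div_mul_eq_mul_div, le_div_iff₀ hp1]
      calc F * √l * (p - 1) = (p - 1) * F * √l := by ring
        _ ≤ 4 * A * √(1 - ρ) * √l := by gcongr
        _ = 4 * A * (√(1 - ρ) * √l) := by ring
        _ ≤ 4 * A * 2 := by gcongr
        _ = _ := by ring
    exact hE3.trans (by gcongr; exact le_max_left _ _)
  · have hE := cubeAvg_energy_rpow_le_of_two_lt hp2 h0 h1 hg
    rw [hu2] at hE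
    have hE' : F ^ p / 2 ≤ (1 - ρ) * (p ^ 2 / 2 * (A ^ 2 * F ^ (p - 2))) :=
      (by linarith : F ^ p / 2 ≤ _).trans hE
    have hFp2 : F ^ p = F ^ 2 * F ^ (p - 2) := by
      rw [← rpow_natCast, ← rpow_add hFpos]; congr 1; push_cast; ring
    have hFq : 0 < F ^ (p - 2) := by positivity
    have hE2 : F ^ 2 ≤ (1 - ρ) * (p ^ 2 * A ^ 2) := by
      refine le_of_mul_le_mul_right ?_ hFq
      rw [← hFp2]; linarith
    have hE3 : F * √l ≤ 2 * p * A := by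
      refine (abs_le_of_sq_le_sq' ?_ (by positivity)).2
      rw [mul_pow, sq_sqrt hl0]
      calc F ^ 2 * l ≤ (1 - ρ) * (p ^ 2 * A ^ 2) * l := by gcongr
        _ = (1 - ρ) * l * (p ^ 2 * A ^ 2) := by ring
        _ ≤ 4 * (p ^ 2 * A ^ 2) := by gcongr
        _ = _ := by ring
    exact hE3.trans (by gcongr; exact le_max_right _ _)

end Powers

/-! ### Complex-valued functions -/

section Complex

variable {n : ℕ}

lemma gradNorm_le_of_norm_dparC_le {F : Type*} [NormedAddCommGroup F] [NormedSpace ℝ F]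
    [NormedSpace ℝ E] {g : Cube n → E} {f : Cube n → F} {x : Cube n}
    (h : ∀ i, ‖dparC i g x‖ ≤ ‖dparC i f x‖) : gradNorm g x ≤ gradNorm f x := by
  refine sqrt_le_sqrt (sum_le_sum fun i _ => ?_)
  gcongr
  exact h i

lemma gradNorm_norm_sub_le [NormedSpace ℝ E] (f : Cube n → E) (m : E) (x : Cube n) :
    gradNorm (fun y => ‖f y - m‖) x ≤ gradNorm f x := by
  refine gradNorm_le_of_norm_dparC_le fun i => ?_
  rw [dparC, dparC, norm_smul, norm_smul]
  gcongr
  simpa using abs_norm_sub_norm_le (f x - m) (f (flipC i x) - m)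

/-- The `L_1` Poincaré inequality for complex functions. -/
lemma cubeAvg_norm_sub_cubeAvg_le (f : Cube n → ℂ) :
    cubeAvg (fun x => ‖f x - cubeAvg f‖) ≤ 4 * cubeAvg (gradNorm f) := by
  have hre : (cubeAvg f).re = cubeAvg fun x => (f x).re := by
    rw [cubeAvg, Complex.smul_re, Complex.re_sum]; rfl
  have him : (cubeAvg f).im = cubeAvg fun x => (f x).im := by
    rw [cubeAvg, Complex.smul_im, Complex.im_sum]; rfl
  have h1 : cubeAvg (gradNorm fun x => (f x).re) ≤ cubeAvg (gradNorm f) :=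
    cubeAvg_mono fun x => gradNorm_le_of_norm_dparC_le fun i => by
      simpa [dparC] using Complex.abs_re_le_norm (dparC i f x)
  have h2 : cubeAvg (gradNorm fun x => (f x).im) ≤ cubeAvg (gradNorm f) :=
    cubeAvg_mono fun x => gradNorm_le_of_norm_dparC_le fun i => by
      simpa [dparC] using Complex.abs_im_le_norm (dparC i f x)
  have h3 := cubeAvg_abs_sub_cubeAvg_le fun x => (f x).re
  have h4 := cubeAvg_abs_sub_cubeAvg_le fun x => (f x).im
  calc _ ≤ cubeAvg (fun x => |(f x).re - cubeAvg fun x => (f x).re| +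
        |(f x).im - cubeAvg fun x => (f x).im|) := by
        refine cubeAvg_mono fun x => ?_
        rw [← hre, ← him, ← Complex.sub_re, ← Complex.sub_im]
        exact Complex.norm_le_abs_re_add_abs_im _
    _ ≤ _ := by rw [cubeAvg_add]; linarith

lemma cubeScalGradLp_eq (p : ℝ) (f : Cube n → ℂ) :
    cubeScalGradLp p f = cubeAvg (fun x => gradNorm f x ^ p) ^ (1 / p) := by
  simp only [cubeScalGradLp, cubeLp, norm_of_nonneg (sqrt_nonneg _)]
  rfl

end Complex

/-- **Scalar-valued `L_1 - L_p` inequality** (Theorem 4).  For every `p ∈ (1,∞)` there exists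
`C_p ∈ (0,∞)` such that every `f : 𝒞_n → ℂ` satisfies
`‖f - E f‖_p ≤ C_p ‖∇f‖_p / (1 + √(log(‖∇f‖_p/‖∇f‖₁)))`.
(When `∇f ≡ 0` the right-hand side is automatically `0`.) -/
theorem l1_lp_inequality_scalar (p : ℝ) (hp : 1 < p) :
    ∃ Cp : ℝ, 0 < Cp ∧ ∀ (n : ℕ) (f : Cube n → ℂ),
      cubeLp p (fun x => f x - cubeAvg f)
        ≤ Cp * (cubeScalGradLp p f /
            (1 + Real.sqrt (Real.log (cubeScalGradLp p f / cubeScalGradLp 1 f)))) := by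
  obtain ⟨C, hC, hlog⟩ := exists_Lp_mul_sqrt_le hp
  have hp0 : 0 < p := by linarith
  refine ⟨max (3 * C) (8 * exp 2), lt_max_of_lt_left (by positivity), fun n f => ?_⟩
  set g : Cube n → ℝ := fun x => ‖f x - cubeAvg f‖
  have hg : ∀ x, 0 ≤ g x := fun x => norm_nonneg _
  have hF : cubeLp p (fun x => f x - cubeAvg f) = cubeAvg (fun x => g x ^ p) ^ (1 / p) := rfl
  have hB : cubeScalGradLp 1 f = cubeAvg (gradNorm f) := by
    simp [cubeScalGradLp_eq]
  have hBA : cubeScalGradLp 1 f ≤ cubeScalGradLp p f := by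
    rw [hB, cubeScalGradLp_eq]
    exact cubeAvg_le_Lp hp.le (gradNorm_nonneg f)
  have hB0 : 0 ≤ cubeScalGradLp 1 f := hB ▸ cubeAvg_nonneg (gradNorm_nonneg f)
  have hP : cubeAvg g ≤ 4 * cubeScalGradLp 1 f := hB ▸ cubeAvg_norm_sub_cubeAvg_le f
  have hA : cubeAvg (fun x => gradNorm g x ^ p) ^ (1 / p) ≤ cubeScalGradLp p f := by
    rw [cubeScalGradLp_eq]
    refine rpow_le_rpow (cubeAvg_nonneg fun x => rpow_nonneg (gradNorm_nonneg g x) _)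
      (cubeAvg_mono fun x => ?_) (by positivity)
    exact rpow_le_rpow (gradNorm_nonneg g x) (gradNorm_norm_sub_le f _ x) hp0.le
  rw [hF]
  replace hlog := fun l => hlog n g l hg
  have hF0 : 0 ≤ cubeAvg (fun x => g x ^ p) ^ (1 / p) :=
    rpow_nonneg (cubeAvg_nonneg fun x => rpow_nonneg (hg x) _) _
  set F := cubeAvg (fun x => g x ^ p) ^ (1 / p)
  set A := cubeScalGradLp p f
  set B := cubeScalGradLp 1 f
  set L := log (A / B)
  have hA0 : 0 ≤ A := hB0.trans hBA
  have hL : 0 ≤ L := by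
    rcases hB0.eq_or_lt with h | h
    · simp [L, ← h]
    · exact log_nonneg ((one_le_div h).2 hBA)
  have hden : 0 < 1 + √L := by positivity
  rw [← mul_div_assoc, le_div_iff₀ hden]
  have hsL : √L ≤ (1 + L) / 2 := by nlinarith [sq_nonneg (√L - 1), sq_sqrt hL]
  rcases le_or_gt (cubeAvg g * exp (2 * (1 + L / 4))) F with h | h
  · have h1 := (hlog _ (by linarith) h).trans (mul_le_mul_of_nonneg_left hA hC.le)
    have h2 : 1 + √L ≤ 3 * √(1 + L / 4) := by
      have h3 : 1 ≤ √(1 + L / 4) := one_le_sqrt.2 (by linarith)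
      have h4 : √L ≤ 2 * √(1 + L / 4) := by
        rw [show (2 : ℝ) = √4 by rw [show (4 : ℝ) = 2 ^ 2 by norm_num]; simp,
          ← sqrt_mul (by norm_num)]
        exact sqrt_le_sqrt (by linarith)
      linarith
    calc F * (1 + √L) ≤ F * (3 * √(1 + L / 4)) := by gcongr
      _ ≤ 3 * C * A := by linarith
      _ ≤ _ := by gcongr; exact le_max_left _ _
  · have hBpos : 0 < B := by
      by_contra! hB
      have : cubeAvg g ≤ 0 := by linarith
      nlinarith [exp_pos (2 * (1 + L / 4))]
    have hAB : A = B * exp L := by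
      rw [exp_log (div_pos (hBpos.trans_le hBA) hBpos)]; field_simp
    have h1 : 1 + √L ≤ 2 * exp (L / 2) := by linarith [add_one_le_exp (L / 2)]
    calc F * (1 + √L) ≤ (4 * B * exp (2 * (1 + L / 4))) * (2 * exp (L / 2)) := by
          gcongr
          exact h.le.trans (by gcongr)
      _ = 8 * exp 2 * A := by
        rw [hAB, show 2 * (1 + L / 4) = 2 + L / 2 by ring, exp_add,
          show exp L = exp (L / 2) * exp (L / 2) by rw [← exp_add]; congr 1; ring]
        ring
      _ ≤ _ := by gcongr; exact le_max_right _ _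

end
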